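/- arXiv:1711.09741 — 2 statements merged into one kernel-verified Lean document; each statement's English description precedes it below -/
import Mathlib

section
/- There exist a real number p ∈ (0,1) and an infinite set F ⊆ ℕ such that the probability that M ~ M(n,n,n;p) contains a Latin square tends to 1 as n → ∞ along F. (In fact one may take F = {2^k : k ∈ ℕ} and any p greater than the unique root p* ≈ 0.9206 of 2x⁴ − x⁸ = x in (0,1).) -/
attribute [local instance] Classical.propDecidable

noncomputable section

/-- The number of ones in an `m × n × k` 0-1 array. -/
def numOnes {m n k : ℕ} (M : Fin m → Fin n → Fin k → Bool) : ℕ :=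
  (Finset.univ.filter (fun x : Fin m × Fin n × Fin k => M x.1 x.2.1 x.2.2 = true)).card

/-- An `m × n × k` 0-1 array is a Latin box if it has exactly `m * n` ones and
every line (fixing two coordinates, varying the third) has at most one `1`. -/
def IsLatinBox {m n k : ℕ} (M : Fin m → Fin n → Fin k → Bool) : Prop :=
  numOnes M = m * n ∧
  (∀ i j, (Finset.univ.filter (fun c => M i j c = true)).card ≤ 1) ∧
  (∀ i c, (Finset.univ.filter (fun j => M i j c = true)).card ≤ 1) ∧
  (∀ j c, (Finset.univ.filter (fun i => M i j c = true)).card ≤ 1)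

/-- `M` contains (supports) a Latin box. -/
def ContainsLatinBox {m n k : ℕ} (M : Fin m → Fin n → Fin k → Bool) : Prop :=
  ∃ L : Fin m → Fin n → Fin k → Bool, IsLatinBox L ∧ ∀ i j c, L i j c = true → M i j c = true

/-- The probability that a random `m × n × k` 0-1 array, whose entries are
independently `1` with probability `p`, satisfies the property `P`. -/
def arrProb (m n k : ℕ) (p : ℝ) (P : (Fin m → Fin n → Fin k → Bool) → Prop) : ℝ :=
  ∑ M : Fin m → Fin n → Fin k → Bool,
    if P M then ∏ i, ∏ j, ∏ c, (if M i j c = true then p else 1 - p) else 0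

/-- The probability of the event `P` for a family of independent Bernoulli(`p`) bits. -/
def bernProb (ι : Type) [Fintype ι] (p : ℝ) (P : (ι → Bool) → Prop) : ℝ :=
  ∑ M : ι → Bool, if P M then ∏ i, (if M i = true then p else 1 - p) else 0

theorem bernProb_true (ι : Type) [Fintype ι] (p : ℝ) :
    bernProb ι p (fun _ => True) = 1 := by
  have h := Finset.prod_univ_sum (fun _ : ι => (Finset.univ : Finset Bool))
    (fun _ b => if b = true then p else 1 - p)
  rw [Fintype.piFinset_univ] at h
  simp only [bernProb, if_true]
  rw [← h]
  simp

theorem bernProb_mono (ι : Type) [Fintype ι] {p : ℝ} (h0 : 0 ≤ p) (h1 : p ≤ 1)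
    {P Q : (ι → Bool) → Prop} (h : ∀ M, P M → Q M) : bernProb ι p P ≤ bernProb ι p Q := by
  refine Finset.sum_le_sum fun M _ => ?_
  have hw : 0 ≤ ∏ i, (if M i = true then p else 1 - p) :=
    Finset.prod_nonneg fun i _ => by split_ifs <;> linarith
  by_cases hP : P M
  · simp [hP, h M hP]
  · rw [if_neg hP]
    split_ifs
    · exact hw
    · exact le_rfl

theorem bernProb_le_one (ι : Type) [Fintype ι] {p : ℝ} (h0 : 0 ≤ p) (h1 : p ≤ 1)
    (P : (ι → Bool) → Prop) : bernProb ι p P ≤ 1 :=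
  (bernProb_mono ι h0 h1 fun _ _ => trivial).trans_eq (bernProb_true ι p)

theorem bernProb_not (ι : Type) [Fintype ι] (p : ℝ) (P : (ι → Bool) → Prop) :
    bernProb ι p (fun M => ¬ P M) = 1 - bernProb ι p P := by
  rw [eq_sub_iff_add_eq, ← bernProb_true ι p, bernProb, bernProb, bernProb,
    ← Finset.sum_add_distrib]
  refine Finset.sum_congr rfl fun M _ => ?_
  by_cases hP : P M <;> simp [hP]

theorem bernProb_congr {ι κ : Type} [Fintype ι] [Fintype κ] (e : ι ≃ κ) (p : ℝ)
    (P : (κ → Bool) → Prop) :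
    bernProb κ p P = bernProb ι p (fun M => P (M ∘ e.symm)) := by
  refine (Fintype.sum_equiv (e.arrowCongr (Equiv.refl Bool)) _ _ fun M => ?_).symm
  have h : (e.arrowCongr (Equiv.refl Bool)) M = M ∘ e.symm := rfl
  rw [h]
  congr 1
  exact Fintype.prod_equiv e _ _ fun i => by simp

/-- Replacing each block of bits by the indicator of an event `B` on that block yields independent
bits whose parameter is the probability of `B`. -/
theorem bernProb_block (ι κ : Type) [Fintype ι] [Fintype κ] (p : ℝ)
    (B : (κ → Bool) → Prop) (P : (ι → Bool) → Prop) :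
    bernProb (ι × κ) p (fun M => P (fun i => decide (B fun k => M (i, k)))) =
      bernProb ι (bernProb κ p B) P := by
  have hq : ∀ b : Bool, (if b = true then bernProb κ p B else 1 - bernProb κ p B) =
      ∑ m : κ → Bool, if decide (B m) = b then ∏ k, (if m k = true then p else 1 - p) else 0 := by
    intro b
    cases b
    · rw [if_neg (by simp), ← bernProb_not]
      refine Finset.sum_congr rfl fun m _ => ?_
      by_cases h : B m <;> simp [h]
    · simp [bernProb]
  have hprod : ∀ N : ι → Bool,
      ∏ i, (if N i = true then bernProb κ p B else 1 - bernProb κ p B) =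
      ∑ m : ι → κ → Bool, if (fun i => decide (B (m i))) = N then
        ∏ i, ∏ k, (if m i k = true then p else 1 - p) else 0 := by
    intro N
    simp_rw [hq]
    rw [Finset.prod_univ_sum, Fintype.piFinset_univ]
    refine Finset.sum_congr rfl fun m _ => ?_
    by_cases h : (fun i => decide (B (m i))) = N
    · subst h
      simp
    · rw [if_neg h]
      obtain ⟨i, hi⟩ := Function.ne_iff.mp h
      exact Finset.prod_eq_zero (Finset.mem_univ i) (if_neg hi)
  have hcurry : bernProb (ι × κ) p (fun M => P (fun i => decide (B fun k => M (i, k)))) =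
      ∑ m : ι → κ → Bool, if P (fun i => decide (B (m i))) then
        ∏ i, ∏ k, (if m i k = true then p else 1 - p) else 0 := by
    unfold bernProb
    refine Finset.sum_equiv (Equiv.curry ι κ Bool) (by simp) fun M _ => ?_
    rw [Fintype.prod_prod_type]
    rfl
  rw [hcurry, bernProb]
  simp_rw [hprod]
  have hpush : ∀ N : ι → Bool, (if P N then (∑ m : ι → κ → Bool,
      if (fun i => decide (B (m i))) = N then
        ∏ i, ∏ k, (if m i k = true then p else 1 - p) else 0) else 0) =
      ∑ m : ι → κ → Bool, if (fun i => decide (B (m i))) = N then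
        (if P N then ∏ i, ∏ k, (if m i k = true then p else 1 - p) else 0) else 0 := by
    intro N
    by_cases hN : P N <;> simp [hN]
  simp_rw [hpush]
  rw [Finset.sum_comm]
  refine Finset.sum_congr rfl fun m _ => ?_
  rw [Finset.sum_ite_eq]
  simp

theorem bernProb_forall (ι : Type) [Fintype ι] (p : ℝ) :
    bernProb ι p (fun M => ∀ i, M i = true) = p ^ Fintype.card ι := by
  rw [bernProb, Finset.sum_eq_single (fun _ => true)]
  · simp
  · intro M _ hM
    obtain ⟨i, hi⟩ := Function.ne_iff.mp hM
    exact if_neg fun h => hi (h i)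
  · simp

theorem bernProb_forall_not (ι : Type) [Fintype ι] (p : ℝ) :
    bernProb ι p (fun M => ∀ i, ¬ M i = true) = (1 - p) ^ Fintype.card ι := by
  rw [bernProb, Finset.sum_eq_single (fun _ => false)]
  · simp
  · intro M _ hM
    obtain ⟨i, hi⟩ := Function.ne_iff.mp hM
    exact if_neg fun h => hi (by simpa using h i)
  · simp

theorem bernProb_exists (ι : Type) [Fintype ι] (p : ℝ) :
    bernProb ι p (fun M => ∃ i, M i = true) = 1 - (1 - p) ^ Fintype.card ι := by
  rw [← bernProb_forall_not, ← bernProb_not]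
  simp

/-- The ones of `M` contain the graph of a Latin square indexed by `α`. -/
def SupportsLatin {α : Type} (M : α × α × α → Bool) : Prop :=
  ∃ g : α → α → α, (∀ i, Function.Injective (g i)) ∧
    (∀ j, Function.Injective fun i => g i j) ∧ ∀ i j, M (i, j, g i j) = true

theorem SupportsLatin.congr {α β : Type} (e : α ≃ β) {M : β × β × β → Bool}
    (h : SupportsLatin fun x : α × α × α => M (e x.1, e x.2.1, e x.2.2)) : SupportsLatin M := by
  obtain ⟨g, h1, h2, h3⟩ := h
  refine ⟨fun i j => e (g (e.symm i) (e.symm j)), fun i => ?_, fun j => ?_, fun i j => ?_⟩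
  · exact e.injective.comp ((h1 _).comp e.symm.injective)
  · exact e.injective.comp ((h2 (e.symm j)).comp e.symm.injective)
  · simpa using h3 (e.symm i) (e.symm j)

/-- The cells of a cube of side `α × Bool`, sorted into blocks of side `2`; the first bit of the
second component tells which of the two Latin squares of order `2` in the block the cell lies in. -/
def blockEquiv (α : Type) :
    (α × α × α) × (Bool × Bool × Bool) ≃ (α × Bool) × (α × Bool) × (α × Bool) where
  toFun x := ((x.1.1, x.2.2.1), (x.1.2.1, x.2.2.2), (x.1.2.2, xor x.2.1 (xor x.2.2.1 x.2.2.2)))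
  invFun y := ((y.1.1, y.2.1.1, y.2.2.1), (xor y.2.2.2 (xor y.1.2 y.2.1.2), y.1.2, y.2.1.2))
  left_inv x := by simp
  right_inv y := by simp

theorem SupportsLatin.of_blocks {α : Type} {M : (α × Bool) × (α × Bool) × (α × Bool) → Bool}
    (h : SupportsLatin fun x : α × α × α =>
      decide (∃ s : Bool, ∀ ab : Bool × Bool, M (blockEquiv α (x, (s, ab))) = true)) :
    SupportsLatin M := by
  obtain ⟨g, h1, h2, h3⟩ := h
  simp only [decide_eq_true_eq] at h3
  choose s hs using h3
  refine ⟨fun i j => (g i.1 j.1, xor (s i.1 j.1) (xor i.2 j.2)), ?_, ?_, ?_⟩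
  · rintro ⟨i, a⟩ ⟨j, b⟩ ⟨j', b'⟩ h
    simp only [Prod.mk.injEq] at h
    obtain rfl := h1 i h.1
    simpa using h.2
  · rintro ⟨j, b⟩ ⟨i, a⟩ ⟨i', a'⟩ h
    simp only [Prod.mk.injEq] at h
    obtain rfl := h2 j h.1
    simpa using h.2
  · rintro ⟨i, a⟩ ⟨j, b⟩
    exact hs i j (a, b)

/-- The probability that a random `2 × 2 × 2` array contains a Latin square. -/
def doublingMap (p : ℝ) : ℝ := 1 - (1 - p ^ 4) ^ 2

theorem bernProb_order_two (p : ℝ) :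
    bernProb (Bool × Bool × Bool) p (fun m => ∃ s, ∀ ab, m (s, ab) = true) = doublingMap p := by
  have h := bernProb_block Bool (Bool × Bool) p (fun m => ∀ ab, m ab = true)
    (fun N => ∃ s, N s = true)
  simp only [decide_eq_true_eq] at h
  rw [h, bernProb_exists, bernProb_forall]
  simp [doublingMap]

theorem bernProb_supportsLatin_double {p : ℝ} (h0 : 0 ≤ p) (h1 : p ≤ 1)
    (α β : Type) [Fintype α] [Fintype β] (e : α × Bool ≃ β) :
    bernProb (α × α × α) (doublingMap p) SupportsLatin ≤
      bernProb (β × β × β) p SupportsLatin := by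
  rw [← bernProb_order_two, ← bernProb_block,
    bernProb_congr ((blockEquiv α).trans (e.prodCongr (e.prodCongr e))) p]
  refine bernProb_mono _ h0 h1 fun M hM => ?_
  apply SupportsLatin.congr e
  apply SupportsLatin.of_blocks
  simpa using hM

theorem one_sub_doublingMap_le {p : ℝ} (h0 : 31 / 32 ≤ p) (h1 : p ≤ 1) :
    1 - doublingMap p ≤ (1 - p) / 2 ∧ doublingMap p ≤ 1 := by
  have hb := one_add_mul_le_pow (show (-2 : ℝ) ≤ p - 1 by linarith) 4
  have hp : p ^ 4 ≤ 1 := pow_le_one₀ (by linarith) h1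
  simp only [add_sub_cancel] at hb
  norm_num at hb
  unfold doublingMap
  constructor
  · nlinarith
  · nlinarith [sq_nonneg (1 - p ^ 4)]

theorem one_sub_le_bernProb_supportsLatin (k : ℕ) : ∀ p : ℝ, 31 / 32 ≤ p → p ≤ 1 →
    1 - (1 - p) / 2 ^ k ≤
      bernProb (Fin (2 ^ k) × Fin (2 ^ k) × Fin (2 ^ k)) p SupportsLatin := by
  induction k with
  | zero =>
    intro p h0 h1
    have h := bernProb_forall (Fin (2 ^ 0) × Fin (2 ^ 0) × Fin (2 ^ 0)) p
    have hm := bernProb_mono (Fin (2 ^ 0) × Fin (2 ^ 0) × Fin (2 ^ 0)) (by linarith) h1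
      (P := fun M => ∀ i, M i = true) (Q := SupportsLatin) fun M hM =>
        ⟨fun i _ => i, fun _ _ _ _ => Subsingleton.elim (α := Fin 1) _ _,
          fun _ _ _ _ => Subsingleton.elim (α := Fin 1) _ _, fun _ _ => hM _⟩
    rw [h] at hm
    simpa using hm
  | succ k ih =>
    intro p h0 h1
    obtain ⟨ha, hb⟩ := one_sub_doublingMap_le h0 h1
    refine le_trans ?_ ((ih (doublingMap p) (by linarith) hb).trans
      (bernProb_supportsLatin_double (by linarith) h1 (Fin (2 ^ k)) (Fin (2 ^ (k + 1)))
        (Fintype.equivOfCardEq (by simp [pow_succ]))))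
    have : (1 - p) / 2 ^ (k + 1) = ((1 - p) / 2) / 2 ^ k := by rw [pow_succ]; field_simp
    rw [this]
    gcongr

theorem SupportsLatin.containsLatinBox {n : ℕ} {M : Fin n → Fin n → Fin n → Bool}
    (h : SupportsLatin fun x : Fin n × Fin n × Fin n => M x.1 x.2.1 x.2.2) :
    ContainsLatinBox M := by
  obtain ⟨g, h1, h2, h3⟩ := h
  refine ⟨fun i j c => decide (g i j = c), ⟨?_, fun i j => ?_, fun i c => ?_, fun j c => ?_⟩, ?_⟩
  · have : (Finset.univ.filter fun x : Fin n × Fin n × Fin n =>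
        decide (g x.1 x.2.1 = x.2.2) = true) =
        (Finset.univ : Finset (Fin n × Fin n)).image fun y => (y.1, y.2, g y.1 y.2) := by
      ext ⟨i, j, c⟩
      simp
    rw [numOnes, this, Finset.card_image_of_injective]
    · simp
    · rintro ⟨i, j⟩ ⟨i', j'⟩ h
      simp only [Prod.mk.injEq] at h
      simp [h.1, h.2.1]
  · refine Finset.card_le_one.mpr fun a ha b hb => ?_
    simp only [Finset.mem_filter, decide_eq_true_eq] at ha hb
    exact ha.2.symm.trans hb.2
  · refine Finset.card_le_one.mpr fun a ha b hb => ?_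
    simp only [Finset.mem_filter, decide_eq_true_eq] at ha hb
    exact h1 i (ha.2.trans hb.2.symm)
  · refine Finset.card_le_one.mpr fun a ha b hb => ?_
    simp only [Finset.mem_filter, decide_eq_true_eq] at ha hb
    exact h2 j (ha.2.trans hb.2.symm)
  · intro i j c hc
    rw [← of_decide_eq_true hc]
    exact h3 i j

theorem arrProb_eq_bernProb (m n k : ℕ) (p : ℝ) (P : (Fin m → Fin n → Fin k → Bool) → Prop) :
    arrProb m n k p P =
      bernProb (Fin m × Fin n × Fin k) p (fun M => P fun i j c => M (i, j, c)) := by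
  unfold arrProb bernProb
  refine (Finset.sum_equiv ((Equiv.curry (Fin m) (Fin n × Fin k) Bool).trans
    (Equiv.piCongrRight fun _ => Equiv.curry (Fin n) (Fin k) Bool)) (by simp) fun M _ => ?_).symm
  simp only [Fintype.prod_prod_type]
  rfl

/-- There exist `p ∈ (0,1)` and an infinite set `F ⊆ ℕ` such that the probability that a
random `n × n × n` 0-1 array with i.i.d. Bernoulli(p) entries contains a Latin square
tends to `1` as `n → ∞` along `F`. -/
theorem stmt0 :
    ∃ p : ℝ, 0 < p ∧ p < 1 ∧ ∃ F : Set ℕ, F.Infinite ∧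
      Filter.Tendsto (fun n : ℕ => arrProb n n n p ContainsLatinBox)
        (Filter.atTop ⊓ Filter.principal F) (nhds 1) := by
  refine ⟨31 / 32, by norm_num, by norm_num, Set.range (fun k : ℕ => 2 ^ k),
    Set.infinite_range_of_injective (Nat.pow_right_injective le_rfl), ?_⟩
  have hlim : Filter.Tendsto (fun n : ℕ => 1 - (1 / 32 : ℝ) / n)
      (Filter.atTop ⊓ Filter.principal (Set.range (fun k : ℕ => 2 ^ k))) (nhds 1) := by
    have h := (tendsto_const_nhds (x := (1 : ℝ))).sub
      (tendsto_const_div_atTop_nhds_zero_nat (1 / 32 : ℝ))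
    rw [sub_zero] at h
    exact h.mono_left inf_le_left
  refine tendsto_of_tendsto_of_tendsto_of_le_of_le' hlim tendsto_const_nhds ?_ ?_
  · refine Filter.Eventually.filter_mono inf_le_right (Filter.eventually_principal.mpr ?_)
    rintro _ ⟨k, rfl⟩
    rw [arrProb_eq_bernProb]
    refine le_trans (le_of_eq ?_) ((one_sub_le_bernProb_supportsLatin k (31 / 32) le_rfl
      (by norm_num)).trans (bernProb_mono _ (by norm_num) (by norm_num) fun M hM => ?_))
    · push_cast
      norm_num
    · exact SupportsLatin.containsLatinBox hM
  · refine Filter.Eventually.of_forall fun n => ?_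
    rw [arrProb_eq_bernProb]
    exact bernProb_le_one _ (by norm_num) (by norm_num) _

end
end

section
/- Fix ε ∈ (0,1) and set m = m(n) = ⌊(1−ε)n⌋. For a sequence p = p(n) ∈ [0,1]: if p·n/log n → 0 then the probability that M ~ M(m,n,n;p) contains a Latin box tends to 0, and if p·n/log n → ∞ then this probability tends to 1. In other words, log(n)/n is a threshold for M(⌊(1−ε)n⌋,n,n;p) to contain a Latin box. -/
attribute [local instance] Classical.propDecidable

noncomputable section

section RegularBipartite

variable {α : Type*}

/-- The number of related pairs `(x, y)` with `x ∈ A` and `y ∈ D`. -/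
def edgeCount (r : α → α → Prop) (A D : Finset α) : ℕ :=
  ∑ x ∈ A, (D.filter (r x)).card

lemma edgeCount_comm (r : α → α → Prop) (A D : Finset α) :
    edgeCount r A D = ∑ y ∈ D, (A.filter (fun x => r x y)).card :=
  Finset.sum_card_bipartiteAbove_eq_sum_card_bipartiteBelow r

lemma card_filter_mul_le_sum (s : Finset α) (f : α → ℕ) (P : α → Prop) [DecidablePred P]
    {c : ℝ} (h : ∀ x ∈ s, P x → c ≤ f x) :
    ((s.filter P).card : ℝ) * c ≤ (∑ x ∈ s, f x : ℕ) := by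
  rw [← nsmul_eq_mul]
  push_cast
  refine (Finset.card_nsmul_le_sum (s.filter P) (fun x => (f x : ℝ)) c ?_).trans ?_
  · intro x hx
    rw [Finset.mem_filter] at hx
    exact h x hx.1 hx.2
  · exact Finset.sum_le_sum_of_subset_of_nonneg (Finset.filter_subset _ _)
      (fun _ _ _ => Nat.cast_nonneg _)

variable [Fintype α] [DecidableEq α]

/-- Every element has exactly `d` neighbours on either side of the bipartite relation `r`. -/
def IsBiregular (r : α → α → Prop) (d : ℕ) : Prop :=
  (∀ x, (Finset.univ.filter (r x)).card = d) ∧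
    ∀ y, (Finset.univ.filter (fun x => r x y)).card = d

lemma card_filter_add_card_filter_compl (P : α → Prop) (B : Finset α) :
    (B.filter P).card + (Bᶜ.filter P).card = (Finset.univ.filter P).card := by
  rw [← Finset.card_union_of_disjoint, ← Finset.filter_union, Finset.union_compl]
  exact Finset.disjoint_filter_filter disjoint_compl_right

lemma IsBiregular.edgeCount_balance {r : α → α → Prop} {d : ℕ} (hr : IsBiregular r d)
    (A B : Finset α) :
    edgeCount r A Bᶜ + d * B.card = edgeCount r Aᶜ B + d * A.card := by
  have h1 : edgeCount r A B + edgeCount r A Bᶜ = d * A.card := by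
    simp only [edgeCount]
    rw [← Finset.sum_add_distrib, Finset.sum_congr rfl
      (fun x _ => (card_filter_add_card_filter_compl (r x) B).trans (hr.1 x))]
    simp [mul_comm]
  have h2 : edgeCount r A B + edgeCount r Aᶜ B = d * B.card := by
    rw [edgeCount_comm, edgeCount_comm, ← Finset.sum_add_distrib, Finset.sum_congr rfl
      (fun y _ => (card_filter_add_card_filter_compl (fun x => r x y) A).trans (hr.2 y))]
    simp [mul_comm]
  omega

/-- The joint neighbourhood of `R`. -/
def nbhd (r : α → α → Prop) (R : Finset α) : Finset α :=
  Finset.univ.filter (fun y => ∃ x ∈ R, r x y)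

/-- The left part of a sparse cut, reconstructed from a dominating set `R` and the exceptional
vertices `F₁` and `F₂`. -/
def decodeLeft (r : α → α → Prop) (d : ℕ) (R F₁ F₂ : Finset α) : Finset α :=
  (Finset.univ.filter (fun x => d < 2 * ((nbhd r R).filter (r x)).card) \ F₂) ∪ F₁

/-- The right part of a sparse cut, reconstructed from its left part `A` and the exceptional
vertices `F₃` and `F₄`. -/
def decodeRight (r : α → α → Prop) (d : ℕ) (A F₃ F₄ : Finset α) : Finset α :=
  (Finset.univ.filter (fun y => d < 2 * (A.filter (fun x => r x y)).card) \ F₃) ∪ F₄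

/-- A cut, reconstructed from a code consisting of five sets. -/
def decode (r : α → α → Prop) (d : ℕ)
    (c : Finset α × Finset α × Finset α × Finset α × Finset α) : Finset α × Finset α :=
  (decodeLeft r d c.1 c.2.1 c.2.2.1,
    decodeRight r d (decodeLeft r d c.1 c.2.1 c.2.2.1) c.2.2.2.1 c.2.2.2.2)

lemma exists_dominating_subset (r : α → α → Prop) (d : ℕ) (S : Finset α) :
    ∃ R ⊆ S, R.card * d ≤ 4 * (nbhd r R).card ∧
      ∀ x ∈ S, 0 < d → 4 * (((nbhd r R)ᶜ).filter (r x)).card < d := by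
  obtain ⟨R, hR, hmax⟩ := Finset.exists_max_image
    (S.powerset.filter (fun R => R.card * d ≤ 4 * (nbhd r R).card)) Finset.card
    ⟨∅, by simp⟩
  rw [Finset.mem_filter, Finset.mem_powerset] at hR
  refine ⟨R, hR.1, hR.2, fun x hx hd => ?_⟩
  by_contra! hcon
  have hxR : x ∉ R := by
    intro hxR
    have : ((nbhd r R)ᶜ).filter (r x) = ∅ := by
      ext y
      simp only [nbhd, Finset.mem_filter, Finset.mem_compl, Finset.mem_univ, true_and,
        Finset.notMem_empty, iff_false, not_and]
      exact fun h hy => h ⟨x, hxR, hy⟩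
    rw [this] at hcon
    simp at hcon
    omega
  have hsub : nbhd r R ∪ ((nbhd r R)ᶜ).filter (r x) ⊆ nbhd r (insert x R) := by
    intro y hy
    simp only [nbhd, Finset.mem_union, Finset.mem_filter, Finset.mem_compl, Finset.mem_univ,
      true_and, Finset.mem_insert] at hy ⊢
    rcases hy with ⟨z, hz, hzy⟩ | ⟨-, hy⟩
    · exact ⟨z, Or.inr hz, hzy⟩
    · exact ⟨x, Or.inl rfl, hy⟩
  have hcard := Finset.card_le_card hsub
  rw [Finset.card_union_of_disjoint
    (Finset.disjoint_of_subset_right (Finset.filter_subset _ _) disjoint_compl_right)] at hcard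
  have hins := Finset.card_insert_of_notMem hxR
  have := hmax (insert x R) (by
    rw [Finset.mem_filter, Finset.mem_powerset]
    refine ⟨Finset.insert_subset hx hR.1, ?_⟩
    rw [hins, add_mul]
    have := hR.2
    omega)
  omega

lemma card_nbhd_inter_le (r : α → α → Prop) (R D : Finset α) :
    (nbhd r R ∩ D).card ≤ ∑ x ∈ R, (D.filter (r x)).card := by
  refine (Finset.card_le_card (t := R.biUnion (fun x => D.filter (r x))) ?_).trans
    Finset.card_biUnion_le
  intro y hy
  simp only [nbhd, Finset.mem_inter, Finset.mem_filter, Finset.mem_univ, true_and,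
    Finset.mem_biUnion] at hy ⊢
  obtain ⟨⟨x, hx, hxy⟩, hy⟩ := hy
  exact ⟨x, hx, hy, hxy⟩

/-- In a dense biregular relation, every cut is encoded by five sets whose sizes are proportional
to the number of edges of the cut. -/
lemma IsBiregular.exists_code {r : α → α → Prop} {d : ℕ} (hr : IsBiregular r d) {ε : ℝ}
    (hε0 : 0 < ε) (hε1 : ε ≤ 1) (hd0 : 0 < d) (hd : ε * Fintype.card α ≤ d) {A B : Finset α}
    (hAB : B.card < A.card) {t : ℕ} (ht : t = ⌊32 * edgeCount r A Bᶜ / (ε * d)⌋₊) :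
    ∃ c : Finset α × Finset α × Finset α × Finset α × Finset α,
      (c.1.card ≤ t ∧ c.2.1.card ≤ t ∧ c.2.2.1.card ≤ t ∧ c.2.2.2.1.card ≤ t ∧
        c.2.2.2.2.card ≤ t) ∧ decode r d c = (A, B) := by
  have hbal := hr.edgeCount_balance A B
  set e := edgeCount r A Bᶜ with he
  have hde : d ≤ e := by nlinarith
  have hback : edgeCount r Aᶜ B ≤ e := by nlinarith
  have hdR : (0 : ℝ) < d := by exact_mod_cast hd0
  have hεd : 0 < ε * d := by positivity
  have heR : (0 : ℝ) ≤ e := Nat.cast_nonneg _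
  have hbackR : (edgeCount r Aᶜ B : ℝ) ≤ e := by exact_mod_cast hback
  have key : ∀ s : Finset α, (s.card : ℝ) * (ε * d) ≤ 32 * e → s.card ≤ t := by
    intro s hs
    rw [ht]
    apply Nat.le_floor
    rwa [le_div_iff₀ hεd]
  have key' : ∀ s : Finset α, (s.card : ℝ) * (d / 8) ≤ e → s.card ≤ t := by
    intro s hs
    apply key
    have : (0 : ℝ) ≤ s.card * d := by positivity
    nlinarith
  set F₁ := A.filter (fun x => ε * d < 32 * (Bᶜ.filter (r x)).card) with hF₁
  set F₂ := Aᶜ.filter (fun x => d < 8 * (B.filter (r x)).card) with hF₂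
  set F₃ := Bᶜ.filter (fun y => d < 2 * (A.filter (fun x => r x y)).card) with hF₃
  set F₄ := B.filter (fun y => ¬ d < 2 * (A.filter (fun x => r x y)).card) with hF₄
  obtain ⟨R, hRS, hRcard, hdom⟩ := exists_dominating_subset r d
    (A.filter (fun x => ¬ ε * d < 32 * (Bᶜ.filter (r x)).card))
  have hnb : ((nbhd r R).card : ℝ) ≤ Fintype.card α := by exact_mod_cast Finset.card_le_univ _
  have hRcardR : (R.card : ℝ) * d ≤ 4 * (nbhd r R).card := by exact_mod_cast hRcard
  have hRε : (R.card : ℝ) * ε ≤ 4 := by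
    have : (R.card : ℝ) * ε * d ≤ 4 * d := by nlinarith
    exact le_of_mul_le_mul_right this hdR
  have hRD : ((nbhd r R ∩ Bᶜ).card : ℝ) * 8 ≤ d := by
    have h1 : ((nbhd r R ∩ Bᶜ).card : ℝ) ≤ ∑ x ∈ R, ((Bᶜ.filter (r x)).card : ℝ) := by
      exact_mod_cast card_nbhd_inter_le r R Bᶜ
    have h2 : ∑ x ∈ R, ((Bᶜ.filter (r x)).card : ℝ) ≤ R.card • (ε * d / 32) := by
      refine Finset.sum_le_card_nsmul _ _ _ (fun x hx => ?_)
      have := (Finset.mem_filter.1 (hRS hx)).2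
      linarith
    rw [nsmul_eq_mul] at h2
    nlinarith
  have hleft : decodeLeft r d R F₁ F₂ = A := by
    ext x
    have hsplit := card_filter_add_card_filter_compl (r x) (nbhd r R)
    rw [hr.1 x] at hsplit
    simp only [decodeLeft, Finset.mem_union, Finset.mem_sdiff, Finset.mem_filter,
      Finset.mem_univ, true_and, hF₁, hF₂, Finset.mem_compl]
    by_cases hx : x ∈ A
    · by_cases hx1 : ε * d < 32 * (Bᶜ.filter (r x)).card
      · simp [hx, hx1]
      · have := hdom x (Finset.mem_filter.2 ⟨hx, hx1⟩) hd0
        simp only [hx, not_true_eq_false, false_and, not_false_eq_true, and_true, iff_true]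
        left
        omega
    · simp only [hx, not_false_eq_true, true_and, false_and, or_false, iff_false, not_and, not_not]
      intro hT
      by_contra hB
      have hsub : (nbhd r R).filter (r x) ⊆ B.filter (r x) ∪ (nbhd r R ∩ Bᶜ) := by
        intro y hy
        simp only [Finset.mem_filter, Finset.mem_union, Finset.mem_inter, Finset.mem_compl] at hy ⊢
        tauto
      have h1 := (Finset.card_le_card hsub).trans (Finset.card_union_le _ _)
      have h2 : (nbhd r R ∩ Bᶜ).card * 8 ≤ d := by exact_mod_cast hRD
      omega
  have hright : decodeRight r d A F₃ F₄ = B := by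
    ext y
    simp only [decodeRight, Finset.mem_union, Finset.mem_sdiff, Finset.mem_filter,
      Finset.mem_univ, true_and, hF₃, hF₄, Finset.mem_compl]
    tauto
  refine ⟨(R, F₁, F₂, F₃, F₄), ⟨key _ ?_, key _ ?_, key' _ ?_, key' _ ?_, key' _ ?_⟩, ?_⟩
  · have : (d : ℝ) ≤ e := by exact_mod_cast hde
    nlinarith
  · have := card_filter_mul_le_sum A (fun x => (Bᶜ.filter (r x)).card)
      (fun x => ε * d < 32 * (Bᶜ.filter (r x)).card) (c := ε * d / 32)
      (fun x _ hx => by linarith)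
    change _ ≤ (e : ℝ) at this
    linarith
  · refine le_trans (card_filter_mul_le_sum Aᶜ (fun x => (B.filter (r x)).card)
      (fun x => d < 8 * (B.filter (r x)).card) (c := (d : ℝ) / 8) (fun x _ hx => ?_)) hbackR
    have : (d : ℝ) < 8 * (B.filter (r x)).card := by exact_mod_cast hx
    linarith
  · rw [he, edgeCount_comm]
    refine card_filter_mul_le_sum Bᶜ (fun y => (A.filter (fun x => r x y)).card)
      (fun y => d < 2 * (A.filter (fun x => r x y)).card) (c := (d : ℝ) / 8) (fun y _ hy => ?_)
    have : (d : ℝ) < 2 * (A.filter (fun x => r x y)).card := by exact_mod_cast hy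
    linarith
  · rw [edgeCount_comm] at hbackR
    refine le_trans (card_filter_mul_le_sum B (fun y => (Aᶜ.filter (fun x => r x y)).card)
      (fun y => ¬ d < 2 * (A.filter (fun x => r x y)).card) (c := (d : ℝ) / 8)
      (fun y _ hy => ?_)) hbackR
    have h1 := card_filter_add_card_filter_compl (fun x => r x y) A
    rw [hr.2 y] at h1
    have : (d : ℝ) ≤ 2 * (Aᶜ.filter (fun x => r x y)).card := by
      have : d ≤ 2 * (Aᶜ.filter (fun x => r x y)).card := by omega
      exact_mod_cast this
    linarith
  · simp [decode, hleft, hright]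

lemma card_filter_card_le (t : ℕ) :
    (Finset.univ.filter (fun s : Finset α => s.card ≤ t)).card ≤ (Fintype.card α + 1) ^ t := by
  induction t with
  | zero =>
    simp [Finset.filter_eq']
  | succ t ih =>
    have hsub : Finset.univ.filter (fun s : Finset α => s.card ≤ t + 1) ⊆
        Finset.image₂ (fun (o : Option α) (s : Finset α) => o.elim s (fun a => insert a s))
          Finset.univ (Finset.univ.filter (fun s : Finset α => s.card ≤ t)) := by
      intro s hs
      simp only [Finset.mem_filter, Finset.mem_univ, true_and] at hs
      simp only [Finset.mem_image₂, Finset.mem_filter, Finset.mem_univ, true_and]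
      rcases s.eq_empty_or_nonempty with rfl | ⟨a, ha⟩
      · exact ⟨none, ∅, by simp, rfl⟩
      · refine ⟨some a, s.erase a, ?_, Finset.insert_erase ha⟩
        rw [Finset.card_erase_of_mem ha]
        omega
    refine (Finset.card_le_card hsub).trans ((Finset.card_image₂_le _ _ _).trans ?_)
    rw [Finset.card_univ, Fintype.card_option, pow_succ, mul_comm]
    exact Nat.mul_le_mul_right _ ih

/-- The number of cuts with exactly `e` edges in a dense biregular relation. -/
lemma IsBiregular.card_cuts_le {r : α → α → Prop} {d : ℕ} (hr : IsBiregular r d) {ε : ℝ}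
    (hε0 : 0 < ε) (hε1 : ε ≤ 1) (hd0 : 0 < d) (hd : ε * Fintype.card α ≤ d) (e : ℕ) :
    (Finset.univ.filter (fun c : Finset α × Finset α =>
      c.2.card < c.1.card ∧ edgeCount r c.1 c.2ᶜ = e)).card ≤
      (Fintype.card α + 1) ^ (5 * ⌊32 * e / (ε * d)⌋₊) := by
  set t := ⌊32 * e / (ε * d)⌋₊ with ht
  set P := Finset.univ.filter (fun s : Finset α => s.card ≤ t) with hP
  have hsub : (Finset.univ.filter (fun c : Finset α × Finset α =>
      c.2.card < c.1.card ∧ edgeCount r c.1 c.2ᶜ = e)) ⊆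
      (P ×ˢ P ×ˢ P ×ˢ P ×ˢ P).image (decode r d) := by
    rintro ⟨A, B⟩ hAB
    simp only [Finset.mem_filter, Finset.mem_univ, true_and] at hAB
    obtain ⟨c, hc, hdec⟩ := hr.exists_code hε0 hε1 hd0 hd hAB.1 (t := t) (by rw [ht, hAB.2])
    refine Finset.mem_image.2 ⟨c, ?_, hdec⟩
    simpa [hP] using hc
  refine (Finset.card_le_card hsub).trans (Finset.card_image_le.trans ?_)
  simp only [Finset.card_product]
  have h := card_filter_card_le (α := α) t
  calc _ = P.card ^ 5 := by ring
    _ ≤ ((Fintype.card α + 1) ^ t) ^ 5 := Nat.pow_le_pow_left h 5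
    _ = _ := by rw [← pow_mul, mul_comm]

lemma IsBiregular.le_edgeCount {r : α → α → Prop} {d : ℕ} (hr : IsBiregular r d)
    {A B : Finset α} (hAB : B.card < A.card) : d ≤ edgeCount r A Bᶜ := by
  have := hr.edgeCount_balance A B
  nlinarith

end RegularBipartite

section RandomRow

lemma sum_prod_prod {ι κ β : Type*} [Fintype ι] [Fintype κ] [Fintype β]
    [DecidableEq ι] [DecidableEq κ]
    (g : ι → κ → β → ℝ) :
    ∑ S : ι → κ → β, ∏ j, ∏ c, g j c (S j c) = ∏ j, ∏ c, ∑ b, g j c b := by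
  have h : ∀ j, ∏ c, ∑ b, g j c b = ∑ v : κ → β, ∏ c, g j c (v c) := fun j => by
    rw [Finset.prod_univ_sum, Fintype.piFinset_univ]
  rw [Finset.prod_congr rfl (fun j _ => h j), Finset.prod_univ_sum, Fintype.piFinset_univ]

variable {n : ℕ}

/-- The probability that the random array with independent Bernoulli(`p`) entries equals `S`. -/
def rowWeight (p : ℝ) (S : Fin n → Fin n → Bool) : ℝ :=
  ∏ j, ∏ c, (if S j c = true then p else 1 - p)

lemma rowWeight_nonneg {p : ℝ} (hp : p ∈ Set.Icc (0 : ℝ) 1) (S : Fin n → Fin n → Bool) :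
    0 ≤ rowWeight p S :=
  Finset.prod_nonneg fun j _ => Finset.prod_nonneg fun c _ => by
    split_ifs
    · exact hp.1
    · linarith [hp.2]

lemma sum_rowWeight (p : ℝ) : ∑ S : Fin n → Fin n → Bool, rowWeight p S = 1 := by
  have := sum_prod_prod (ι := Fin n) (κ := Fin n)
    (fun _ _ (b : Bool) => if b = true then p else 1 - p)
  rw [show (∑ S : Fin n → Fin n → Bool, rowWeight p S) = _ from this]
  simp

lemma sum_rowWeight_no_edges (p : ℝ) (r : Fin n → Fin n → Prop) (A D : Finset (Fin n)) :
    (∑ S : Fin n → Fin n → Bool,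
      if ∀ j ∈ A, ∀ c ∈ D, r j c → S j c = false then rowWeight p S else 0) =
      (1 - p) ^ edgeCount r A D := by
  have h : ∀ S : Fin n → Fin n → Bool,
      (if ∀ j ∈ A, ∀ c ∈ D, r j c → S j c = false then rowWeight p S else 0) =
      ∏ j, ∏ c, (if (j ∈ A ∧ c ∈ D ∧ r j c) ∧ S j c = true then 0
        else if S j c = true then p else 1 - p) := by
    intro S
    split_ifs with hS
    · refine Finset.prod_congr rfl fun j _ => Finset.prod_congr rfl fun c _ => ?_
      refine (if_neg ?_).symm
      rintro ⟨⟨hj, hc, hr⟩, h⟩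
      simp [hS j hj c hc hr] at h
    · push Not at hS
      obtain ⟨j, hj, c, hc, hr, h⟩ := hS
      symm
      refine Finset.prod_eq_zero (Finset.mem_univ j) (Finset.prod_eq_zero (Finset.mem_univ c) ?_)
      rw [if_pos]
      exact ⟨⟨hj, hc, hr⟩, by simpa using h⟩
  rw [Finset.sum_congr rfl (fun S _ => h S)]
  refine (sum_prod_prod (fun j c (b : Bool) =>
    if (j ∈ A ∧ c ∈ D ∧ r j c) ∧ b = true then 0 else if b = true then p else 1 - p)).trans ?_
  have h2 : ∀ j c, (∑ b : Bool, if (j ∈ A ∧ c ∈ D ∧ r j c) ∧ b = true then 0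
      else if b = true then p else 1 - p) =
      if j ∈ A then (if c ∈ D then (if r j c then 1 - p else 1) else 1) else 1 := by
    intro j c
    rw [Fintype.sum_bool]
    by_cases hj : j ∈ A <;> by_cases hc : c ∈ D <;> by_cases hr : r j c <;> simp [hj, hc, hr]
  simp_rw [h2]
  rw [edgeCount, ← Finset.prod_pow_eq_pow_sum, ← Finset.prod_subset (Finset.subset_univ A)]
  · refine Finset.prod_congr rfl fun j hj => ?_
    simp only [hj, if_true]
    rw [← Finset.prod_const, Finset.prod_filter, ← Finset.prod_subset (Finset.subset_univ D)]
    · exact Finset.prod_congr rfl fun c hc => by simp [hc]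
    · intro c _ hc
      simp [hc]
  · intro j _ hj
    simp [hj]

/-- The pairs related by `r` that are ones of `S` support a perfect matching. -/
def HasMatching (r : Fin n → Fin n → Prop) (S : Fin n → Fin n → Bool) : Prop :=
  ∃ σ : Equiv.Perm (Fin n), ∀ j, r j (σ j) ∧ S j (σ j) = true

lemma exists_violator_of_not_hasMatching {r : Fin n → Fin n → Prop} {S : Fin n → Fin n → Bool}
    (h : ¬ HasMatching r S) :
    ∃ A B : Finset (Fin n), B.card < A.card ∧
      ∀ j ∈ A, ∀ c ∈ Bᶜ, r j c → S j c = false := by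
  by_contra! hcon
  apply h
  obtain ⟨f, hf, hfm⟩ := (Finset.all_card_le_biUnion_card_iff_exists_injective
    (fun j : Fin n => Finset.univ.filter (fun c => r j c ∧ S j c = true))).1 (by
      intro A
      by_contra! hA
      obtain ⟨j, hj, c, hc, hr, hS⟩ := hcon A _ hA
      apply Finset.mem_compl.1 hc
      simp only [Finset.mem_biUnion, Finset.mem_filter, Finset.mem_univ, true_and]
      exact ⟨j, hj, hr, by simpa using hS⟩)
  refine ⟨Equiv.ofBijective f (Finite.injective_iff_bijective.1 hf), fun j => ?_⟩
  simpa using hfm j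

/-- The union bound over Hall violators. -/
lemma sum_not_hasMatching_le {p : ℝ} (hp : p ∈ Set.Icc (0 : ℝ) 1) (r : Fin n → Fin n → Prop) :
    (∑ S : Fin n → Fin n → Bool, if ¬ HasMatching r S then rowWeight p S else 0) ≤
      ∑ c ∈ Finset.univ.filter (fun c : Finset (Fin n) × Finset (Fin n) => c.2.card < c.1.card),
        (1 - p) ^ edgeCount r c.1 c.2ᶜ := by
  simp_rw [← sum_rowWeight_no_edges]
  rw [Finset.sum_comm]
  refine Finset.sum_le_sum fun S _ => ?_
  have hnn : ∀ c ∈ Finset.univ.filter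
      (fun c : Finset (Fin n) × Finset (Fin n) => c.2.card < c.1.card),
      0 ≤ (if ∀ j ∈ c.1, ∀ x ∈ c.2ᶜ, r j x → S j x = false then rowWeight p S else 0) := by
    intro c _
    split_ifs
    · exact rowWeight_nonneg hp S
    · exact le_rfl
  split_ifs with h
  · exact Finset.sum_nonneg hnn
  · obtain ⟨A, B, hAB, hS⟩ := exists_violator_of_not_hasMatching h
    refine le_trans (le_of_eq ?_) (Finset.single_le_sum hnn
      (Finset.mem_filter.2 ⟨Finset.mem_univ (A, B), hAB⟩))
    rw [if_pos hS]

lemma cut_term_le {ε p : ℝ} {d e : ℕ} (hn : 2 ≤ n) (hε0 : 0 < ε) (hp : p ∈ Set.Icc (0 : ℝ) 1)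
    (hpn : (320 / ε ^ 2 + 5 / ε) * Real.log n ≤ p * n) (hd : ε * n ≤ d) (hde : d ≤ e) :
    ((n : ℝ) + 1) ^ (5 * ⌊32 * e / (ε * d)⌋₊) * (1 - p) ^ e ≤ 1 / (n : ℝ) ^ 5 := by
  have hn2 : (2 : ℝ) ≤ n := by exact_mod_cast hn
  have hn0 : (0 : ℝ) < n := by linarith
  have hd0 : (0 : ℝ) < d := lt_of_lt_of_le (by positivity) hd
  have hde' : (d : ℝ) ≤ e := by exact_mod_cast hde
  have he0 : (0 : ℝ) < e := by linarith
  set L := Real.log n with hL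
  have hL0 : 0 < L := Real.log_pos (by linarith)
  have hlog : Real.log ((n : ℝ) + 1) ≤ 2 * L := by
    rw [hL, show (2 : ℝ) * Real.log n = Real.log ((n : ℝ) ^ 2) by rw [Real.log_pow]; norm_num]
    exact Real.log_le_log (by linarith) (by nlinarith)
  have hlog0 : 0 ≤ Real.log ((n : ℝ) + 1) := Real.log_nonneg (by linarith)
  have hfl : ((5 * ⌊32 * e / (ε * d)⌋₊ : ℕ) : ℝ) ≤ 160 / ε ^ 2 * (e / n) := by
    have h1 : (⌊32 * e / (ε * d)⌋₊ : ℝ) ≤ 32 * e / (ε * d) := Nat.floor_le (by positivity)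
    have h2 : 32 * e / (ε * d) ≤ 32 * e / (ε * (ε * n)) := by gcongr
    have h3 : 5 * (32 * e / (ε * (ε * n))) = 160 / ε ^ 2 * (e / n) := by
      field_simp
      norm_num
    push_cast
    linarith
  have hx : ((n : ℝ) + 1) ^ (5 * ⌊32 * e / (ε * d)⌋₊) ≤
      Real.exp (320 / ε ^ 2 * (e / n) * L) := by
    nth_rewrite 1 [← Real.exp_log (show (0 : ℝ) < (n : ℝ) + 1 by linarith)]
    rw [← Real.exp_nat_mul, Real.exp_le_exp]
    calc _ ≤ 160 / ε ^ 2 * (e / n) * (2 * L) := by gcongr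
      _ = _ := by ring
  have hy : (1 - p) ^ e ≤ Real.exp (-(e * p)) := by
    calc (1 - p) ^ e ≤ Real.exp (-p) ^ e :=
          pow_le_pow_left₀ (by linarith [hp.2]) (Real.one_sub_le_exp_neg p) e
      _ = _ := by rw [← Real.exp_nat_mul]; ring_nf
  have hz : 1 / (n : ℝ) ^ 5 = Real.exp (-(5 * L)) := by
    rw [Real.exp_neg, show (5 : ℝ) * L = Real.log ((n : ℝ) ^ 5) by rw [Real.log_pow]; norm_num [hL],
      Real.exp_log (by positivity), one_div]
  rw [hz]
  refine (mul_le_mul hx hy (pow_nonneg (by linarith [hp.2]) _) (Real.exp_pos _).le).trans ?_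
  rw [← Real.exp_add, Real.exp_le_exp]
  have hp' : (320 / ε ^ 2 + 5 / ε) * L * (e / n) ≤ e * p := by
    calc _ ≤ p * n * (e / n) := by gcongr
      _ = e * p := by field_simp
  have h5 : 5 * L ≤ 5 / ε * L * (e / n) := by
    have : 1 ≤ e / (ε * n) := by
      rw [le_div_iff₀ (by positivity)]
      linarith
    calc 5 * L = 5 * L * 1 := by ring
      _ ≤ 5 * L * (e / (ε * n)) := by gcongr
      _ = _ := by field_simp
  nlinarith

/-- A random subset of a dense biregular relation has a perfect matching with high probability. -/
lemma IsBiregular.sum_hasMatching_ge {r : Fin n → Fin n → Prop} {d : ℕ} (hr : IsBiregular r d)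
    {ε p : ℝ} (hn : 2 ≤ n) (hε0 : 0 < ε) (hε1 : ε ≤ 1) (hp : p ∈ Set.Icc (0 : ℝ) 1)
    (hpn : (320 / ε ^ 2 + 5 / ε) * Real.log n ≤ p * n) (hd : ε * n ≤ d) :
    1 - ((n : ℝ) ^ 2 + 1) * (1 / (n : ℝ) ^ 5) ≤
      ∑ S : Fin n → Fin n → Bool, if HasMatching r S then rowWeight p S else 0 := by
  have hd0 : 0 < d := by
    have hn0 : (0 : ℝ) < n := by exact_mod_cast (by omega : 0 < n)
    have : (0 : ℝ) < d := lt_of_lt_of_le (by positivity) hd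
    exact_mod_cast this
  have hsum : (∑ S : Fin n → Fin n → Bool, if HasMatching r S then rowWeight p S else 0) +
      (∑ S : Fin n → Fin n → Bool, if ¬ HasMatching r S then rowWeight p S else 0) = 1 := by
    rw [← Finset.sum_add_distrib, ← sum_rowWeight (n := n) p]
    refine Finset.sum_congr rfl fun S _ => ?_
    by_cases h : HasMatching r S <;> simp [h]
  have hbound : (∑ S : Fin n → Fin n → Bool, if ¬ HasMatching r S then rowWeight p S else 0) ≤
      ((n : ℝ) ^ 2 + 1) * (1 / (n : ℝ) ^ 5) := by
    refine (sum_not_hasMatching_le hp r).trans ?_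
    have hmaps : ∀ c ∈ Finset.univ.filter
        (fun c : Finset (Fin n) × Finset (Fin n) => c.2.card < c.1.card),
        edgeCount r c.1 c.2ᶜ ∈ Finset.range (n ^ 2 + 1) := by
      intro c _
      rw [Finset.mem_range, Nat.lt_succ_iff]
      refine (Finset.sum_le_card_nsmul _ _ n fun x _ => card_finset_fin_le _).trans ?_
      rw [smul_eq_mul, pow_two]
      exact Nat.mul_le_mul_right _ (card_finset_fin_le _)
    rw [← Finset.sum_fiberwise_of_maps_to hmaps]
    refine (Finset.sum_le_card_nsmul _ _ (1 / (n : ℝ) ^ 5) fun e _ => ?_).trans (le_of_eq ?_)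
    · rw [Finset.sum_congr rfl (g := fun _ => (1 - p) ^ e)
        (fun c hc => by rw [(Finset.mem_filter.1 hc).2]), Finset.sum_const, nsmul_eq_mul,
        Finset.filter_filter]
      by_cases hde : d ≤ e
      · refine le_trans ?_ (cut_term_le hn hε0 hp hpn hd hde)
        refine mul_le_mul_of_nonneg_right ?_ (pow_nonneg (by linarith [hp.2]) _)
        have := hr.card_cuts_le hε0 hε1 hd0 (by simpa using hd) e
        rw [Fintype.card_fin] at this
        exact_mod_cast this
      · rw [Finset.filter_eq_empty_iff.2]
        · simp
        · rintro c - ⟨h1, h2⟩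
          exact hde (h2 ▸ hr.le_edgeCount h1)
    · simp
  linarith

end RandomRow

section LatinRectangle

variable {m n : ℕ}

/-- The array supports `m` pairwise disjoint permutations, one in each of its layers. -/
def HasLatinRectangle (M : Fin m → Fin n → Fin n → Bool) : Prop :=
  ∃ σ : Fin m → Equiv.Perm (Fin n),
    (∀ j, Function.Injective (fun i => σ i j)) ∧ ∀ i j, M i j (σ i j) = true

lemma HasLatinRectangle.containsLatinBox {M : Fin m → Fin n → Fin n → Bool}
    (h : HasLatinRectangle M) : ContainsLatinBox M := by
  obtain ⟨σ, hσ, hM⟩ := h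
  refine ⟨fun i j c => decide (σ i j = c), ⟨?_, ?_, ?_, ?_⟩, ?_⟩
  · have : Finset.univ.filter
        (fun x : Fin m × Fin n × Fin n => decide (σ x.1 x.2.1 = x.2.2) = true) =
        Finset.univ.image (fun y : Fin m × Fin n => (y.1, y.2, σ y.1 y.2)) := by
      ext ⟨i, j, c⟩
      simp only [decide_eq_true_eq, Finset.mem_filter, Finset.mem_univ, true_and,
        Finset.mem_image, Prod.exists, Prod.mk.injEq]
      constructor
      · rintro rfl
        exact ⟨i, j, rfl, rfl, rfl⟩
      · rintro ⟨i', j', rfl, rfl, rfl⟩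
        rfl
    rw [numOnes, this, Finset.card_image_of_injective]
    · simp
    · rintro ⟨i, j⟩ ⟨i', j'⟩ h
      simp only [Prod.mk.injEq] at h ⊢
      exact ⟨h.1, h.2.1⟩
  · intro i j
    rw [Finset.card_le_one]
    simp +contextual
  · intro i c
    rw [Finset.card_le_one]
    simp only [decide_eq_true_eq, Finset.mem_filter, Finset.mem_univ, true_and]
    intro a ha b hb
    exact (σ i).injective (ha.trans hb.symm)
  · intro j c
    rw [Finset.card_le_one]
    simp only [decide_eq_true_eq, Finset.mem_filter, Finset.mem_univ, true_and]
    intro a ha b hb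
    exact hσ j (ha.trans hb.symm)
  · intro i j c hc
    rw [decide_eq_true_eq] at hc
    exact hc ▸ hM i j

/-- The cells unused by a Latin rectangle form a biregular relation. -/
lemma isBiregular_unused {σ : Fin m → Equiv.Perm (Fin n)}
    (hσ : ∀ j, Function.Injective (fun i => σ i j)) :
    IsBiregular (fun j c => ∀ i, σ i j ≠ c) (n - m) := by
  refine ⟨fun j => ?_, fun c => ?_⟩
  · have himage : ((Finset.univ.image (fun i => σ i j))ᶜ).card = n - m := by
      rw [Finset.card_compl, Finset.card_image_of_injective _ (hσ j)]
      simp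
    rw [← himage]
    congr 1
    ext c
    simp
  · have hinj : Function.Injective (fun i => (σ i).symm c) := by
      intro i i' h
      apply hσ ((σ i).symm c)
      change (σ i).symm c = (σ i').symm c at h
      change σ i ((σ i).symm c) = σ i' ((σ i).symm c)
      rw [Equiv.apply_symm_apply, h, Equiv.apply_symm_apply]
    have himage : ((Finset.univ.image (fun i => (σ i).symm c))ᶜ).card = n - m := by
      rw [Finset.card_compl, Finset.card_image_of_injective _ hinj]
      simp
    rw [← himage]
    congr 1
    ext j
    simp [Equiv.symm_apply_eq, eq_comm (a := c)]

lemma hasLatinRectangle_cons {M : Fin m → Fin n → Fin n → Bool} {S : Fin n → Fin n → Bool}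
    {σ : Fin m → Equiv.Perm (Fin n)} (hσ : ∀ j, Function.Injective (fun i => σ i j))
    (hM : ∀ i j, M i j (σ i j) = true) (hS : HasMatching (fun j c => ∀ i, σ i j ≠ c) S) :
    HasLatinRectangle (Fin.cons S M : Fin (m + 1) → Fin n → Fin n → Bool) := by
  obtain ⟨τ, hτ⟩ := hS
  refine ⟨Fin.cons τ σ, fun j => ?_, fun i => ?_⟩
  · intro a b
    refine Fin.cases ?_ (fun a => ?_) a <;> refine Fin.cases ?_ (fun b => ?_) b
    · simp
    · intro h
      simp only [Fin.cons_zero, Fin.cons_succ] at h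
      exact absurd h.symm ((hτ j).1 b)
    · intro h
      simp only [Fin.cons_zero, Fin.cons_succ] at h
      exact absurd h ((hτ j).1 a)
    · intro h
      simp only [Fin.cons_succ] at h
      rw [hσ j h]
  · refine Fin.cases ?_ (fun i => ?_) i
    · simpa using fun j => (hτ j).2
    · simpa using hM i

lemma arrProb_eq (p : ℝ) (P : (Fin m → Fin n → Fin n → Bool) → Prop) :
    arrProb m n n p P = ∑ M, if P M then ∏ i, rowWeight p (M i) else 0 :=
  rfl

lemma arrProb_mono {p : ℝ} (hp : p ∈ Set.Icc (0 : ℝ) 1)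
    {P Q : (Fin m → Fin n → Fin n → Bool) → Prop} (h : ∀ M, P M → Q M) :
    arrProb m n n p P ≤ arrProb m n n p Q := by
  rw [arrProb_eq, arrProb_eq]
  refine Finset.sum_le_sum fun M _ => ?_
  have h0 : 0 ≤ ∏ i, rowWeight p (M i) := Finset.prod_nonneg fun i _ => rowWeight_nonneg hp _
  by_cases hP : P M
  · simp [hP, h M hP]
  · rw [if_neg hP]
    split_ifs
    · exact h0
    · exact le_rfl

lemma arrProb_nonneg {p : ℝ} (hp : p ∈ Set.Icc (0 : ℝ) 1)
    (P : (Fin m → Fin n → Fin n → Bool) → Prop) : 0 ≤ arrProb m n n p P := by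
  refine le_trans (le_of_eq ?_) (arrProb_mono hp (P := fun _ => False) (fun _ h => h.elim))
  simp [arrProb_eq]

lemma arrProb_le_one {p : ℝ} (hp : p ∈ Set.Icc (0 : ℝ) 1)
    (P : (Fin m → Fin n → Fin n → Bool) → Prop) : arrProb m n n p P ≤ 1 := by
  refine (arrProb_mono hp (Q := fun _ => True) (fun _ _ => trivial)).trans (le_of_eq ?_)
  simp only [arrProb_eq, if_true]
  have h := Finset.prod_univ_sum (fun _ : Fin m => (Finset.univ : Finset (Fin n → Fin n → Bool)))
    (fun _ S => rowWeight p S)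
  rw [Fintype.piFinset_univ] at h
  rw [← h]
  simp [sum_rowWeight]

/-- Building the Latin rectangle layer by layer. -/
lemma pow_le_arrProb_hasLatinRectangle {p q : ℝ} (hp : p ∈ Set.Icc (0 : ℝ) 1) (hq : 0 ≤ q)
    {k : ℕ}
    (h : ∀ (r : Fin n → Fin n → Prop) (d : ℕ), IsBiregular r d → n ≤ k + d →
      q ≤ ∑ S : Fin n → Fin n → Bool, if HasMatching r S then rowWeight p S else 0) :
    ∀ m ≤ k, q ^ m ≤ arrProb m n n p HasLatinRectangle := by
  intro m
  induction m with
  | zero =>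
    intro _
    rw [arrProb_eq]
    have : ∀ M : Fin 0 → Fin n → Fin n → Bool, HasLatinRectangle M := fun M =>
      ⟨fun i => i.elim0, fun _ i => i.elim0, fun i => i.elim0⟩
    simp [this]
  | succ m ih =>
    intro hm
    rw [arrProb_eq, ← (Fin.consEquiv (fun _ => Fin n → Fin n → Bool)).sum_comp,
      Fintype.sum_prod_type_right]
    have ih' := ih (by omega)
    rw [arrProb_eq] at ih'
    rw [pow_succ]
    refine (mul_le_mul_of_nonneg_right ih' hq).trans ?_
    rw [Finset.sum_mul]
    refine Finset.sum_le_sum fun M _ => ?_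
    have h0 : 0 ≤ ∏ i, rowWeight p (M i) := Finset.prod_nonneg fun i _ => rowWeight_nonneg hp _
    split_ifs with hM
    · obtain ⟨σ, hσ, hMσ⟩ := hM
      refine (mul_le_mul_of_nonneg_left
        (h _ _ (isBiregular_unused hσ) (by omega)) h0).trans ?_
      rw [Finset.mul_sum]
      refine Finset.sum_le_sum fun S _ => ?_
      have hprod : ∏ i, rowWeight p ((Fin.consEquiv (fun _ => Fin n → Fin n → Bool)) (S, M) i) =
          (∏ i, rowWeight p (M i)) * rowWeight p S := by
        rw [Fin.prod_univ_succ, mul_comm]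
        simp [Fin.consEquiv]
      rw [hprod]
      by_cases hS : HasMatching (fun j c => ∀ i, σ i j ≠ c) S
      · rw [if_pos hS]
        exact (if_pos (hasLatinRectangle_cons hσ hMσ hS)).ge
      · rw [if_neg hS, mul_zero]
        split_ifs
        · exact mul_nonneg h0 (rowWeight_nonneg hp S)
        · exact le_rfl
    · rw [zero_mul]
      refine Finset.sum_nonneg fun S _ => ?_
      split_ifs
      · exact Finset.prod_nonneg fun i _ => rowWeight_nonneg hp _
      · exact le_rfl

lemma ContainsLatinBox.exists_one {M : Fin m → Fin n → Fin n → Bool} (h : ContainsLatinBox M)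
    (i : Fin m) (j : Fin n) : ∃ c, M i j c = true := by
  obtain ⟨L, ⟨hL, h1, -, -⟩, hLM⟩ := h
  by_contra! hcon
  have hsum : numOnes L =
      ∑ y : Fin m × Fin n, (Finset.univ.filter (fun c => L y.1 y.2 c = true)).card := by
    simp only [numOnes, Finset.card_filter]
    rw [Fintype.sum_prod_type, Fintype.sum_prod_type]
    exact Finset.sum_congr rfl fun i _ => Fintype.sum_prod_type _
  have hlt : ∑ y : Fin m × Fin n, (Finset.univ.filter (fun c => L y.1 y.2 c = true)).card <
      ∑ _y : Fin m × Fin n, 1 := by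
    refine Finset.sum_lt_sum (fun y _ => h1 y.1 y.2) ⟨(i, j), Finset.mem_univ _, ?_⟩
    rw [Nat.lt_one_iff, Finset.card_eq_zero, Finset.filter_eq_empty_iff]
    exact fun c _ hc => hcon c (hLM i j c hc)
  rw [← hsum, hL] at hlt
  simp at hlt

lemma arrProb_containsLatinBox_le {p : ℝ} (hp : p ∈ Set.Icc (0 : ℝ) 1) :
    arrProb m n n p ContainsLatinBox ≤ (1 - (1 - p) ^ n) ^ (m * n) := by
  refine (arrProb_mono hp (Q := fun M => ∀ i j, ∃ c, M i j c = true)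
    (fun M h => h.exists_one)).trans (le_of_eq ?_)
  set g : (Fin n → Bool) → ℝ := fun v =>
    if ∃ c, v c = true then ∏ c, (if v c = true then p else 1 - p) else 0 with hg
  have h1 : ∀ M : Fin m → Fin n → Fin n → Bool,
      (if ∀ i j, ∃ c, M i j c = true then ∏ i, rowWeight p (M i) else 0) =
      ∏ i, ∏ j, g (M i j) := by
    intro M
    split_ifs with hM
    · exact Finset.prod_congr rfl fun i _ => Finset.prod_congr rfl fun j _ => by
        rw [hg]; simp only; rw [if_pos (hM i j)]
    · push Not at hM
      obtain ⟨i, j, hij⟩ := hM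
      symm
      refine Finset.prod_eq_zero (Finset.mem_univ i) (Finset.prod_eq_zero (Finset.mem_univ j) ?_)
      rw [hg]
      simp only
      rw [if_neg]
      push Not
      exact hij
  have h2 : ∑ v : Fin n → Bool, g v = 1 - (1 - p) ^ n := by
    have htot : ∑ v : Fin n → Bool, ∏ c, (if v c = true then p else 1 - p) = 1 := by
      have h := Finset.prod_univ_sum (fun _ : Fin n => (Finset.univ : Finset Bool))
        (fun _ b => if b = true then p else 1 - p)
      rw [Fintype.piFinset_univ] at h
      rw [← h]
      simp
    have hsplit : ∀ v : Fin n → Bool, g v = (∏ c, (if v c = true then p else 1 - p)) -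
        if v = (fun _ => false) then (1 - p) ^ n else 0 := by
      intro v
      by_cases hv : ∃ c, v c = true
      · have : v ≠ fun _ => false := by
          rintro rfl
          simp at hv
        simp [hg, hv, this]
      · have : v = fun _ => false := by
          funext c
          simpa using not_exists.1 hv c
        simp [hg, this]
    rw [Finset.sum_congr rfl (fun v _ => hsplit v), Finset.sum_sub_distrib, htot]
    simp
  rw [arrProb_eq]
  refine Eq.trans (b := ∑ M : Fin m → Fin n → Fin n → Bool, ∏ i, ∏ j, g (M i j))
    (Finset.sum_congr rfl fun M _ => ?_) ?_
  · convert h1 M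
  rw [sum_prod_prod (fun _ _ => g), h2]
  simp [← pow_mul, mul_comm]

end LatinRectangle

section Threshold

open Filter

lemma tendsto_natFloor_mul_atTop {ε : ℝ} (hε : ε < 1) :
    Tendsto (fun n : ℕ => ((⌊(1 - ε) * (n : ℝ)⌋₊ : ℕ) : ℝ)) atTop atTop :=
  tendsto_natCast_atTop_atTop.comp (tendsto_nat_floor_atTop.comp
    (tendsto_natCast_atTop_atTop.const_mul_atTop (by linarith)))

/-- Below the threshold, some line contains no one at all. -/
lemma arrProb_containsLatinBox_le_exp {m n : ℕ} {p : ℝ} (hn : 2 ≤ n)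
    (hp : p ∈ Set.Icc (0 : ℝ) 1) (hpn : 2 * (p * n) ≤ Real.log n) :
    arrProb m n n p ContainsLatinBox ≤ Real.exp (-m) := by
  have hn0 : (0 : ℝ) < n := by exact_mod_cast (by omega : 0 < n)
  have hlog : Real.log n ≤ n := (Real.log_le_sub_one_of_pos hn0).trans (by linarith)
  have hp2 : 2 * p ≤ 1 := by
    have : 2 * p * n ≤ 1 * n := by linarith
    exact le_of_mul_le_mul_right this hn0
  have h1 : Real.exp (-(2 * p)) ≤ 1 - p := by
    have h2 := Real.add_one_le_exp (2 * p)
    have h3 : (1 - p) * Real.exp (2 * p) ≥ 1 := by nlinarith [hp.1]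
    rw [Real.exp_neg, inv_le_iff_one_le_mul₀ (Real.exp_pos _)]
    exact h3
  have h2 : 1 / (n : ℝ) ≤ (1 - p) ^ n := by
    calc 1 / (n : ℝ) = Real.exp (-Real.log n) := by
          rw [Real.exp_neg, Real.exp_log hn0, one_div]
      _ ≤ Real.exp (n * (-(2 * p))) := Real.exp_le_exp.2 (by linarith)
      _ = Real.exp (-(2 * p)) ^ n := Real.exp_nat_mul _ _
      _ ≤ (1 - p) ^ n := pow_le_pow_left₀ (Real.exp_pos _).le h1 n
  have h3 : 0 ≤ 1 - (1 - p) ^ n := by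
    have : (1 - p) ^ n ≤ 1 := pow_le_one₀ (by linarith) (by linarith [hp.1])
    linarith
  calc arrProb m n n p ContainsLatinBox ≤ (1 - (1 - p) ^ n) ^ (m * n) :=
        arrProb_containsLatinBox_le hp
    _ ≤ Real.exp (-(1 / (n : ℝ))) ^ (m * n) :=
        pow_le_pow_left₀ h3 ((Real.one_sub_le_exp_neg _).trans
          (Real.exp_le_exp.2 (by linarith))) _
    _ = Real.exp (-m) := by
        rw [← Real.exp_nat_mul]
        congr 1
        push_cast
        field_simp

/-- Above the threshold, a Latin box is contained with high probability. -/
lemma le_arrProb_containsLatinBox {m n : ℕ} {ε p : ℝ} (hn : 2 ≤ n) (hε0 : 0 < ε) (hε1 : ε ≤ 1)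
    (hp : p ∈ Set.Icc (0 : ℝ) 1)
    (hpn : (320 / ε ^ 2 + 5 / ε) * Real.log n ≤ p * n) (hm : (m : ℝ) ≤ (1 - ε) * n) :
    1 - 2 / (n : ℝ) ≤ arrProb m n n p ContainsLatinBox := by
  have hn2 : (2 : ℝ) ≤ n := by exact_mod_cast hn
  have hn0 : (0 : ℝ) < n := by linarith
  set δ : ℝ := ((n : ℝ) ^ 2 + 1) * (1 / (n : ℝ) ^ 5) with hδ
  have hδ2 : n * δ ≤ 2 / n := by
    rw [hδ, mul_one_div, mul_div_assoc', div_le_div_iff₀ (by positivity) hn0]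
    have h2 : (0 : ℝ) ≤ n ^ 2 := by positivity
    have h3 : (n : ℝ) ^ 2 * 1 ≤ n ^ 2 * n ^ 3 := by
      gcongr
      exact one_le_pow₀ (by linarith)
    have h4 : (n : ℝ) ^ 4 * 1 ≤ n ^ 4 * n := by
      gcongr
      linarith
    nlinarith
  have hδ0 : 0 ≤ δ := by positivity
  have hδ1 : δ ≤ 1 := by
    have h1 : 2 / (n : ℝ) ≤ 1 := by rw [div_le_one hn0]; exact hn2
    nlinarith
  have hmn : (m : ℝ) ≤ n := by nlinarith
  calc 1 - 2 / (n : ℝ) ≤ 1 + m * (-δ) := by nlinarith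
    _ ≤ (1 + -δ) ^ m := one_add_mul_le_pow (by linarith) m
    _ = (1 - δ) ^ m := by rw [← sub_eq_add_neg]
    _ ≤ arrProb m n n p HasLatinRectangle := by
        refine pow_le_arrProb_hasLatinRectangle hp (by linarith) (k := m)
          (fun r d hr hd => hr.sum_hasMatching_ge hn hε0 hε1 hp hpn ?_) m le_rfl
        have : (n : ℝ) ≤ m + d := by exact_mod_cast hd
        linarith
    _ ≤ arrProb m n n p ContainsLatinBox := arrProb_mono hp fun _ h => h.containsLatinBox

end Threshold

/-- For fixed `ε ∈ (0,1)` and `m = ⌊(1−ε)n⌋`, `log n / n` is a threshold for a random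
`m × n × n` array (i.i.d. Bernoulli(p n) entries) to contain a Latin box: if
`p·n/log n → 0` the probability tends to `0`, and if `p·n/log n → ∞` it tends to `1`. -/
theorem stmt3 (ε : ℝ) (hε : ε ∈ Set.Ioo (0 : ℝ) 1) (p : ℕ → ℝ)
    (hp : ∀ n, p n ∈ Set.Icc (0 : ℝ) 1) :
    (Filter.Tendsto (fun n : ℕ => p n * n / Real.log n) Filter.atTop (nhds 0) →
      Filter.Tendsto (fun n : ℕ => arrProb ⌊(1 - ε) * (n : ℝ)⌋₊ n n (p n) ContainsLatinBox)
        Filter.atTop (nhds 0)) ∧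
    (Filter.Tendsto (fun n : ℕ => p n * n / Real.log n) Filter.atTop Filter.atTop →
      Filter.Tendsto (fun n : ℕ => arrProb ⌊(1 - ε) * (n : ℝ)⌋₊ n n (p n) ContainsLatinBox)
        Filter.atTop (nhds 1)) := by
  have hlarge : ∀ᶠ n : ℕ in Filter.atTop, 2 ≤ n := Filter.eventually_ge_atTop 2
  have hlog : ∀ n : ℕ, 2 ≤ n → 0 < Real.log n := fun n hn =>
    Real.log_pos (by exact_mod_cast (by omega : 1 < n))
  refine ⟨fun h => ?_, fun h => ?_⟩
  · refine tendsto_of_tendsto_of_tendsto_of_le_of_le' tendsto_const_nhds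
      (Real.tendsto_exp_neg_atTop_nhds_zero.comp (tendsto_natFloor_mul_atTop hε.2))
      (Filter.Eventually.of_forall fun n => arrProb_nonneg (hp n) _) ?_
    filter_upwards [h.eventually (gt_mem_nhds (show (0 : ℝ) < 1 / 2 by norm_num)), hlarge]
      with n hn hn2
    rw [div_lt_iff₀ (hlog n hn2)] at hn
    exact arrProb_containsLatinBox_le_exp hn2 (hp n) (by linarith)
  · refine tendsto_of_tendsto_of_tendsto_of_le_of_le' (g := fun n : ℕ => 1 - 2 / (n : ℝ)) ?_
      tendsto_const_nhds ?_ (Filter.Eventually.of_forall fun n => arrProb_le_one (hp n) _)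
    · simpa using tendsto_const_nhds.sub (tendsto_const_div_atTop_nhds_zero_nat (2 : ℝ))
    · filter_upwards [h.eventually_ge_atTop (320 / ε ^ 2 + 5 / ε), hlarge] with n hn hn2
      rw [le_div_iff₀ (hlog n hn2)] at hn
      exact le_arrProb_containsLatinBox hn2 hε.1 hε.2.le (hp n) hn
        (Nat.floor_le (mul_nonneg (by linarith [hε.2]) (Nat.cast_nonneg n)))

end
end
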